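/- Let E ⊆ H be precisely monotone and let ∂E denote the topological frontier of E. Then either ∂E is contained in a plane, or ∂E = H. -/

import Mathlib

open MeasureTheory Set Topology Filter

noncomputable section

/-- The Heisenberg group as a set: `ℝ³`. -/
abbrev Heis : Type := ℝ × ℝ × ℝ

/-- The Heisenberg group multiplication
`(a,b,c)·(a',b',c') = (a+a', b+b', c+c'+a·b')`. -/
def hMul (x y : Heis) : Heis :=
  (x.1 + y.1, x.2.1 + y.2.1, x.2.2 + y.2.2 + x.1 * y.2.1)

/-- The abelianization homomorphism `π : H → ℝ²`, `π(a,b,c) = (a,b)`. -/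
def hPi (x : Heis) : ℝ × ℝ := (x.1, x.2.1)

/-- The (horizontal) line of the Heisenberg group through `g` with direction `(a,b)`:
`{g·(ta, tb, t²ab/2) : t ∈ ℝ}`. -/
def hLine (g : Heis) (a b : ℝ) : Set Heis :=
  {p | ∃ t : ℝ, p = hMul g (t * a, t * b, t ^ 2 * a * b / 2)}

/-- A subset of the Heisenberg group is a (horizontal) line. -/
def IsLine (L : Set Heis) : Prop :=
  ∃ g : Heis, ∃ a b : ℝ, ¬(a = 0 ∧ b = 0) ∧ L = hLine g a b

/-- Two lines of `H` are parallel if their `π`-images are parallel straight lines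
in `ℝ²`, i.e. their direction vectors are linearly dependent. -/
def AreParallelLines (L₁ L₂ : Set Heis) : Prop :=
  ∃ g₁ g₂ : Heis, ∃ a₁ b₁ a₂ b₂ : ℝ,
    ¬(a₁ = 0 ∧ b₁ = 0) ∧ ¬(a₂ = 0 ∧ b₂ = 0) ∧
    L₁ = hLine g₁ a₁ b₁ ∧ L₂ = hLine g₂ a₂ b₂ ∧ a₁ * b₂ = a₂ * b₁

/-- Two lines of `H` are skew if they are disjoint and not parallel. -/
def AreSkewLines (L₁ L₂ : Set Heis) : Prop :=
  IsLine L₁ ∧ IsLine L₂ ∧ Disjoint L₁ L₂ ∧ ¬ AreParallelLines L₁ L₂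

/-- A straight line in `ℝ²`. -/
def IsLineR2 (l : Set (ℝ × ℝ)) : Prop :=
  ∃ p v : ℝ × ℝ, v ≠ 0 ∧ l = {q | ∃ t : ℝ, q = p + t • v}

/-- The horizontal plane centered at `g`: the union of all lines through `g`. -/
def horizPlane (g : Heis) : Set Heis :=
  {p | ∃ L : Set Heis, IsLine L ∧ g ∈ L ∧ p ∈ L}

/-- A plane of the Heisenberg group: a vertical plane `π⁻¹(ℓ)` for a straight line
`ℓ ⊂ ℝ²`, or a horizontal plane. -/
def IsPlane (P : Set Heis) : Prop :=
  (∃ l : Set (ℝ × ℝ), IsLineR2 l ∧ P = hPi ⁻¹' l) ∨ (∃ g : Heis, P = horizPlane g)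

/-- A half-space of the Heisenberg group: a connected component of the complement
of a plane. -/
def IsHalfSpace (C : Set Heis) : Prop :=
  ∃ P : Set Heis, ∃ x : Heis, IsPlane P ∧ x ∉ P ∧ C = connectedComponentIn Pᶜ x

/-- A subset `E` of the Heisenberg group is precisely monotone if every line
intersects both `E` and its complement in connected sets. -/
def IsPreciselyMonotone (E : Set Heis) : Prop :=
  ∀ L : Set Heis, IsLine L → IsPreconnected (L ∩ E) ∧ IsPreconnected (L ∩ Eᶜ)

/-- Two points are horizontally related when they lie on a common line, in the coordinates
`(a, b, 2c - ab)`, in which lines are affine. -/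
def HRel (p q : Heis) : Prop := q.2.2 - p.2.2 = p.1 * q.2.1 - p.2.1 * q.1

/-- The point at parameter `t` on the line through `p` with direction `(a, b)`, in the
coordinates `(a, b, 2c - ab)`. -/
def hPt (p : Heis) (a b t : ℝ) : Heis :=
  (p.1 + t * a, p.2.1 + t * b, p.2.2 + t * (p.1 * b - p.2.1 * a))

/-- Half of precise monotonicity: beyond a point outside of `E`, as seen from a point of `E`,
lines stay outside of `E`. -/
def RayMonotone (E : Set Heis) : Prop :=
  ∀ x y : Heis, ∀ α : ℝ, HRel x y → 0 < α → x ∈ E → y ∉ E → y + α • (y - x) ∉ E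

/-- `B` contains every line that it meets in two points. -/
def LineClosed (B : Set Heis) : Prop :=
  ∀ p q : Heis, p ≠ q → HRel p q → p ∈ B → q ∈ B → ∀ t : ℝ, p + t • (q - p) ∈ B

/-- Coordinates on the Heisenberg group in which all lines are affine. -/
def affineCoord : Heis ≃ₜ Heis where
  toFun p := (p.1, p.2.1, 2 * p.2.2 - p.1 * p.2.1)
  invFun p := (p.1, p.2.1, (p.2.2 + p.1 * p.2.1) / 2)
  left_inv p := by ext <;> simp
  right_inv p := by ext <;> simp; ring
  continuous_toFun := by fun_prop
  continuous_invFun := by fun_prop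

theorem affineCoord_symm_apply (p : Heis) :
    affineCoord.symm p = (p.1, p.2.1, (p.2.2 + p.1 * p.2.1) / 2) := rfl

theorem affineCoord_symm_hPt (p : Heis) (a b t : ℝ) :
    affineCoord.symm (hPt p a b t) =
      hMul (affineCoord.symm p) (t * a, t * b, t ^ 2 * a * b / 2) := by
  simp only [affineCoord_symm_apply, hPt, hMul, Prod.mk.injEq, true_and]
  ring

theorem HRel.symm {p q : Heis} (h : HRel p q) : HRel q p := by
  unfold HRel at *; linarith

theorem HRel.smul_right {p q : Heis} (h : HRel p q) (t : ℝ) : HRel p (p + t • (q - p)) := by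
  simp only [HRel, Prod.fst_add, Prod.snd_add, Prod.smul_fst, Prod.smul_snd, Prod.fst_sub,
    Prod.snd_sub, smul_eq_mul] at *
  linear_combination t * h

theorem HRel.smul_smul {p q : Heis} (h : HRel p q) (s t : ℝ) :
    HRel (p + s • (q - p)) (p + t • (q - p)) := by
  simp only [HRel, Prod.fst_add, Prod.snd_add, Prod.smul_fst, Prod.smul_snd, Prod.fst_sub,
    Prod.snd_sub, smul_eq_mul] at *
  linear_combination (t - s) * h

theorem hRel_hPt (p : Heis) (a b s t : ℝ) : HRel (hPt p a b s) (hPt p a b t) := by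
  simp only [HRel, hPt]; ring

@[simp] theorem hPt_zero (p : Heis) (a b : ℝ) : hPt p a b 0 = p := by simp [hPt]

theorem hPt_hPt (p : Heis) (a b s t : ℝ) : hPt (hPt p a b s) a b t = hPt p a b (s + t) := by
  simp only [hPt, Prod.mk.injEq]; refine ⟨?_, ?_, ?_⟩ <;> ring

theorem hRel_self_hPt (p : Heis) (a b t : ℝ) : HRel p (hPt p a b t) := by
  simpa using hRel_hPt p a b 0 t

theorem HRel.eq_hPt {p q : Heis} (h : HRel p q) (t : ℝ) :
    p + t • (q - p) = hPt p (q.1 - p.1) (q.2.1 - p.2.1) t := by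
  simp only [HRel] at h
  ext
  · simp [hPt]
  · simp [hPt]
  · simp only [hPt, Prod.snd_add, Prod.smul_snd, Prod.snd_sub, smul_eq_mul]
    linear_combination t * h

theorem HRel.eq_hPt_one {p q : Heis} (h : HRel p q) :
    q = hPt p (q.1 - p.1) (q.2.1 - p.2.1) 1 := by
  rw [← h.eq_hPt]; simp

theorem HRel.dir_ne {p q : Heis} (h : HRel p q) (hne : p ≠ q) :
    ¬(q.1 - p.1 = 0 ∧ q.2.1 - p.2.1 = 0) := by
  rintro ⟨h1, h2⟩
  apply hne
  have := h.eq_hPt_one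
  rw [h1, h2] at this
  rw [this]; simp [hPt]

/-! ### From lines to rays -/

theorem rayMonotone_of_isPreconnected {E : Set Heis}
    (hE : ∀ L : Set Heis, IsLine L → IsPreconnected (L ∩ E)) :
    RayMonotone (affineCoord.symm ⁻¹' E) := by
  intro x y α hxy hα hx hy hz
  have hne : x ≠ y := by rintro rfl; exact hy hx
  have hdir := hxy.dir_ne hne
  have hzE : y + α • (y - x) = x + (1 + α) • (y - x) := by module
  rw [hzE, hxy.eq_hPt] at hz
  have hy' := hxy.eq_hPt_one
  set a := y.1 - x.1
  set b := y.2.1 - x.2.1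
  have hpos : 0 < a ^ 2 + b ^ 2 := by
    rcases not_and_or.1 hdir with h | h
    · positivity
    · positivity
  have hc := hE (hLine (affineCoord.symm x) a b) ⟨_, a, b, hdir, rfl⟩
  have hmem : ∀ t, affineCoord.symm (hPt x a b t) ∈ hLine (affineCoord.symm x) a b :=
    fun t => ⟨t, affineCoord_symm_hPt x a b t⟩
  let f : Heis → ℝ := fun p => a * (p.1 - x.1) + b * (p.2.1 - x.2.1)
  have hf : Continuous f := by fun_prop
  have hft : ∀ t, f (affineCoord.symm (hPt x a b t)) = t * (a ^ 2 + b ^ 2) := by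
    intro t; simp only [f, affineCoord_symm_apply, hPt]; ring
  have hoc := (hc.image f hf.continuousOn).ordConnected
  have h0 : (0 : ℝ) * (a ^ 2 + b ^ 2) ∈ f '' (hLine (affineCoord.symm x) a b ∩ E) :=
    ⟨_, ⟨hmem 0, by simpa using hx⟩, hft 0⟩
  have h1 : (1 + α) * (a ^ 2 + b ^ 2) ∈ f '' (hLine (affineCoord.symm x) a b ∩ E) :=
    ⟨_, ⟨hmem _, hz⟩, hft _⟩
  obtain ⟨w, ⟨⟨t, hwt⟩, hwE⟩, hw⟩ := hoc.out h0 h1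
    (show 1 * (a ^ 2 + b ^ 2) ∈ Icc _ _ from ⟨by nlinarith, by nlinarith⟩)
  rw [← affineCoord_symm_hPt] at hwt
  rw [hwt, hft] at hw
  have ht : t = 1 := mul_right_cancel₀ hpos.ne' hw
  rw [ht, ← hy'] at hwt
  exact hy (by rw [mem_preimage, ← hwt]; exact hwE)

/-! ### The frontier is closed under lines -/

/-- A point horizontally related to both `q` and `s`, which is their midpoint when `q` and `s` are
themselves related. -/
def hMid (q s : Heis) : Heis :=
  let k := (s.2.2 - q.2.2 - (q.1 * s.2.1 - q.2.1 * s.1)) /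
    ((s.1 - q.1) ^ 2 + (s.2.1 - q.2.1) ^ 2)
  let x := (q.1 + s.1) / 2 + k * (s.2.1 - q.2.1)
  let y := (q.2.1 + s.2.1) / 2 - k * (s.1 - q.1)
  (x, y, q.2.2 + (q.1 * y - q.2.1 * x))

theorem hRel_hMid_left (q s : Heis) : HRel q (hMid q s) := by
  simp only [HRel, hMid]; ring

theorem hRel_hMid_right {q s : Heis} (h : (s.1 - q.1) ^ 2 + (s.2.1 - q.2.1) ^ 2 ≠ 0) :
    HRel (hMid q s) s := by
  simp only [HRel, hMid]
  field_simp
  ring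

theorem HRel.hMid_eq {q s : Heis} (h : HRel q s) : hMid q s = (1 / 2 : ℝ) • (q + s) := by
  simp only [HRel] at h
  have h0 : s.2.2 - q.2.2 - (q.1 * s.2.1 - q.2.1 * s.1) = 0 := by linarith
  simp only [hMid, h0]
  ext <;> simp
  · ring
  · ring
  · linear_combination -h / 2

theorem continuousAt_hMid {q s : Heis} (h : (s.1 - q.1) ^ 2 + (s.2.1 - q.2.1) ^ 2 ≠ 0) :
    ContinuousAt (fun w : Heis × Heis => hMid w.1 w.2) (q, s) := by
  unfold hMid
  have hk : ContinuousAt (fun w : Heis × Heis =>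
      (w.2.2.2 - w.1.2.2 - (w.1.1 * w.2.2.1 - w.1.2.1 * w.2.1)) /
        ((w.2.1 - w.1.1) ^ 2 + (w.2.2.1 - w.1.2.1) ^ 2)) (q, s) :=
    ContinuousAt.div (by fun_prop) (by fun_prop) h
  fun_prop

theorem RayMonotone.mem_interior_compl {E : Set Heis} (hE : RayMonotone E) {p q : Heis} {σ : ℝ}
    (hpq : HRel p q) (hne : p ≠ q) (hσ : 0 < σ) (hp : p ∈ interior E) (hq : q ∈ closure Eᶜ) :
    q + σ • (q - p) ∈ interior Eᶜ := by
  set s := q + σ • (q - p) with hs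
  have hqs : HRel q s := by
    have h := hpq.smul_smul 1 (1 + σ)
    have e1 : p + (1 : ℝ) • (q - p) = q := by module
    have e2 : p + (1 + σ) • (q - p) = s := by rw [hs]; module
    rwa [e1, e2] at h
  have hw : (s.1 - q.1) ^ 2 + (s.2.1 - q.2.1) ^ 2 ≠ 0 := by
    have hd := hpq.dir_ne hne
    have e1 : s.1 - q.1 = σ * (q.1 - p.1) := by simp [hs]
    have e2 : s.2.1 - q.2.1 = σ * (q.2.1 - p.2.1) := by simp [hs]
    rw [e1, e2]
    rcases not_and_or.1 hd with h | h
    · positivity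
    · positivity
  have hm := continuousAt_hMid hw
  have hmid := hqs.hMid_eq
  have hE' : E ∈ 𝓝 p := mem_interior_iff_mem_nhds.1 hp
  have t1 : Tendsto (fun w : Heis × Heis => w.1 - (2 / σ) • (hMid w.1 w.2 - w.1)) (𝓝 (q, s))
      (𝓝 p) := by
    have h : ContinuousAt (fun w : Heis × Heis => w.1 - (2 / σ) • (hMid w.1 w.2 - w.1)) (q, s) :=
      by fun_prop
    have e : q - (2 / σ) • (hMid q s - q) = p := by
      rw [hmid, hs]; match_scalars <;> field_simp <;> ring
    have h' := h.tendsto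
    simp only [e] at h'
    exact h'
  have t2 : Tendsto (fun w : Heis × Heis => hMid w.1 w.2 - ((2 + σ) / σ) • (w.2 - hMid w.1 w.2))
      (𝓝 (q, s)) (𝓝 p) := by
    have h : ContinuousAt (fun w : Heis × Heis =>
        hMid w.1 w.2 - ((2 + σ) / σ) • (w.2 - hMid w.1 w.2)) (q, s) := by fun_prop
    have e : hMid q s - ((2 + σ) / σ) • (s - hMid q s) = p := by
      rw [hmid, hs]; match_scalars <;> field_simp <;> ring
    have h' := h.tendsto
    simp only [e] at h'
    exact h'
  have t3 : ∀ᶠ w : Heis × Heis in 𝓝 (q, s),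
      (w.2.1 - w.1.1) ^ 2 + (w.2.2.1 - w.1.2.1) ^ 2 ≠ 0 := by
    have h : ContinuousAt (fun w : Heis × Heis =>
      (w.2.1 - w.1.1) ^ 2 + (w.2.2.1 - w.1.2.1) ^ 2) (q, s) := by fun_prop
    exact h.eventually_ne hw
  have key : ∀ᶠ w : Heis × Heis in 𝓝 (q, s), w.1 ∉ E → w.2 ∉ E := by
    filter_upwards [t1 hE', t2 hE', t3] with w h1 h2 h3 hq'
    have r1 : hMid w.1 w.2 ∉ E := by
      have hrel : HRel (w.1 - (2 / σ) • (hMid w.1 w.2 - w.1)) w.1 := by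
        have h := (hRel_hMid_left w.1 w.2).smul_right (-(2 / σ))
        rw [neg_smul, ← sub_eq_add_neg] at h
        exact h.symm
      have h := hE _ _ (σ / 2) hrel (by positivity) h1 hq'
      convert h using 2
      match_scalars <;> field_simp <;> ring
    have hrel : HRel (hMid w.1 w.2 - ((2 + σ) / σ) • (w.2 - hMid w.1 w.2)) (hMid w.1 w.2) := by
      have h := (hRel_hMid_right h3).smul_right (-((2 + σ) / σ))
      rw [neg_smul, ← sub_eq_add_neg] at h
      exact h.symm
    have h := hE _ _ (σ / (2 + σ)) hrel (by positivity) h2 r1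
    convert h using 2
    match_scalars <;> field_simp <;> ring
  rw [nhds_prod_eq] at key
  obtain ⟨U, hU, V, hV, hUV⟩ := eventually_prod_iff.1 key
  obtain ⟨q', hq'U, hq'E⟩ := mem_closure_iff_nhds.1 hq _ hU
  exact mem_interior_iff_mem_nhds.2 (mem_of_superset hV fun s' hs' => hUV hq'U hs' hq'E)

theorem mem_closure_compl_of_mem_frontier {E : Set Heis} {x : Heis} (hx : x ∈ frontier E) :
    x ∈ closure Eᶜ := by
  rw [frontier_eq_closure_inter_closure] at hx
  exact hx.2

theorem notMem_interior_compl_of_mem_frontier {E : Set Heis} {x : Heis} (hx : x ∈ frontier E) :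
    x ∉ interior Eᶜ := by
  rw [interior_compl]
  exact fun h => h (frontier_subset_closure hx)

theorem RayMonotone.notMem_interior {E : Set Heis} (hE : RayMonotone E) (hE' : RayMonotone Eᶜ)
    {p q : Heis} (hpq : HRel p q) (hp : p ∈ frontier E) (hq : q ∈ frontier E)
    (t : ℝ) : p + t • (q - p) ∉ interior E := by
  intro hx
  set x := p + t • (q - p) with hxdef
  have hxp : HRel x p := (hpq.smul_right t).symm
  have hxq : HRel x q := by
    have h := hpq.smul_smul t 1
    have e1 : p + (1 : ℝ) • (q - p) = q := by module
    rwa [e1] at h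
  have hp' := mem_closure_compl_of_mem_frontier hp
  have hq' := mem_closure_compl_of_mem_frontier hq
  have hnep : x ≠ p := fun h => hp.2 (h ▸ hx)
  have hneq : x ≠ q := fun h => hq.2 (h ▸ hx)
  have ht0 : t ≠ 0 := by rintro rfl; simp [hxdef] at hnep
  have ht1 : t ≠ 1 := by rintro rfl; simp [hxdef] at hneq
  rcases lt_or_gt_of_ne ht0 with h0 | h0
  · have h := hE.mem_interior_compl (σ := -1 / t) hxp hnep (div_pos_of_neg_of_neg (by norm_num) h0)
      hx hp'
    refine notMem_interior_compl_of_mem_frontier hq ?_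
    convert h using 1
    rw [hxdef]; match_scalars <;> field_simp <;> ring
  rcases lt_or_gt_of_ne ht1 with h1 | h1
  · have hq2 := interior_subset (hE.mem_interior_compl (σ := 1) hxq hneq one_pos hx hq')
    have hp2 := interior_subset (hE.mem_interior_compl (σ := 1) hxp hnep one_pos hx hp')
    have e1 : q + (1 : ℝ) • (q - x) = p + (2 - t) • (q - p) := by rw [hxdef]; module
    have e2 : p + (1 : ℝ) • (p - x) = p + (-t) • (q - p) := by rw [hxdef]; module
    rw [e1] at hq2
    rw [e2] at hp2
    have h := hE' _ x ((1 - t) / t) (hpq.smul_smul (-t) t) (div_pos (by linarith) h0) hp2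
      (fun h => h (interior_subset hx))
    apply h
    convert hq2 using 1
    rw [hxdef]; match_scalars <;> field_simp <;> ring
  · have h := hE.mem_interior_compl (σ := 1 / (t - 1)) hxq hneq
      (div_pos one_pos (by linarith)) hx hq'
    have ht : t - 1 ≠ 0 := by intro h; exact ht1 (by linarith)
    refine notMem_interior_compl_of_mem_frontier hp ?_
    convert h using 1
    rw [hxdef]; match_scalars <;> field_simp <;> ring

theorem RayMonotone.lineClosed_frontier {E : Set Heis} (hE : RayMonotone E)
    (hE' : RayMonotone Eᶜ) : LineClosed (frontier E) := by
  intro p q hne hpq hp hq t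
  have h1 := hE.notMem_interior hE' hpq hp hq t
  have h2 := hE'.notMem_interior (by rwa [compl_compl]) hpq (by rwa [frontier_compl])
    (by rwa [frontier_compl]) t
  rw [interior_compl, notMem_compl_iff] at h2
  exact ⟨h2, h1⟩

theorem IsPreconnected.inter_frontier_nonempty_of_interior {X : Type*} [TopologicalSpace X]
    {s E : Set X} (hs : IsPreconnected s) (h : (s ∩ interior E).Nonempty)
    (h' : (s ∩ interior Eᶜ).Nonempty) : (s ∩ frontier E).Nonempty := by
  by_contra hcon
  have hsub : s ⊆ interior E ∪ interior Eᶜ := by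
    intro x hx
    by_contra hx'
    rw [interior_compl, mem_union, not_or, notMem_compl_iff] at hx'
    exact hcon ⟨x, hx, hx'.2, hx'.1⟩
  obtain ⟨x, -, hx, hx'⟩ := hs _ _ isOpen_interior isOpen_interior hsub h h'
  exact interior_subset hx' (interior_subset hx)

theorem RayMonotone.exists_line {E : Set Heis} (hE : RayMonotone E) (hE' : RayMonotone Eᶜ)
    {p : Heis} (hp : p ∈ frontier E) :
    ∃ a b : ℝ, ¬(a = 0 ∧ b = 0) ∧ ∀ t, hPt p a b t ∈ frontier E := by
  suffices h : ∃ q, p ≠ q ∧ HRel p q ∧ q ∈ frontier E by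
    obtain ⟨q, hne, hpq, hq⟩ := h
    refine ⟨_, _, hpq.dir_ne hne, fun t => ?_⟩
    rw [← hpq.eq_hPt]
    exact hE.lineClosed_frontier hE' p q hne hpq hp hq t
  let γ : ℝ → Heis := fun θ => hPt p (Real.cos θ) (Real.sin θ) 1
  have hγ : Continuous γ := by unfold γ hPt; fun_prop
  have hne : ∀ θ, p ≠ γ θ := by
    intro θ h
    have h1 := congrArg (fun w : Heis => w.1) h
    have h2 := congrArg (fun w : Heis => w.2.1) h
    simp only [γ, hPt, one_mul, left_eq_add] at h1 h2
    have := Real.sin_sq_add_cos_sq θ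
    rw [h1, h2] at this
    norm_num at this
  have hpre : IsPreconnected (range γ) := isPreconnected_range hγ
  suffices h : (range γ ∩ frontier E).Nonempty by
    obtain ⟨_, ⟨θ, rfl⟩, h⟩ := h
    exact ⟨_, hne θ, hRel_self_hPt _ _ _ _, h⟩
  by_cases h0 : γ 0 ∈ frontier E
  · exact ⟨_, mem_range_self 0, h0⟩
  have hπ : γ Real.pi = p + (1 : ℝ) • (p - γ 0) := by
    ext <;> simp [γ, hPt]
  have hrel : HRel (γ 0) p := (hRel_self_hPt _ _ _ _).symm
  rw [frontier, Set.mem_sdiff, not_and_or, not_not] at h0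
  rcases h0 with h0 | h0
  · rw [← mem_compl_iff, ← interior_compl] at h0
    have h := hE'.mem_interior_compl hrel (hne 0).symm one_pos h0
      (by rw [compl_compl]; exact frontier_subset_closure hp)
    rw [← hπ, compl_compl] at h
    exact hpre.inter_frontier_nonempty_of_interior ⟨_, mem_range_self _, h⟩
      ⟨_, mem_range_self _, h0⟩
  · have h := hE.mem_interior_compl hrel (hne 0).symm one_pos h0
      (mem_closure_compl_of_mem_frontier hp)
    rw [← hπ] at h
    exact hpre.inter_frontier_nonempty_of_interior ⟨_, mem_range_self _, h0⟩
      ⟨_, mem_range_self _, h⟩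

/-! ### Sets closed under lines -/

theorem LineClosed.hPt_mem {B : Set Heis} (hB : LineClosed B) {p : Heis} {a b s t : ℝ}
    (hab : ¬(a = 0 ∧ b = 0)) (hst : s ≠ t) (hs : hPt p a b s ∈ B) (ht : hPt p a b t ∈ B) (r : ℝ) :
    hPt p a b r ∈ B := by
  have hts : t - s ≠ 0 := sub_ne_zero.2 hst.symm
  have hne : hPt p a b s ≠ hPt p a b t := by
    intro h
    simp only [hPt, Prod.mk.injEq, add_right_inj, mul_eq_mul_right_iff] at h
    exact hab ⟨h.1.resolve_left hst, h.2.1.resolve_left hst⟩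
  have h := hB _ _ hne (hRel_hPt p a b s t) hs ht ((r - s) / (t - s))
  convert h using 1
  ext <;> simp [hPt] <;> field_simp <;> ring

theorem exists_two_roots {A C : ℝ} (hA : A ≠ 0) :
    ∃ s t : ℝ, s ≠ t ∧ A * s ^ 2 + C * s - A = 0 ∧ A * t ^ 2 + C * t - A = 0 := by
  have hpos : 0 < C ^ 2 + 4 * A ^ 2 := by positivity
  set d := √(C ^ 2 + 4 * A ^ 2)
  have hd : 0 < d := Real.sqrt_pos.2 hpos
  have hd2 : d ^ 2 = C ^ 2 + 4 * A ^ 2 := Real.sq_sqrt hpos.le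
  refine ⟨(-C + d) / (2 * A), (-C - d) / (2 * A), ?_, ?_, ?_⟩
  · intro h
    rw [div_left_inj' (by positivity)] at h
    linarith
  · field_simp; linear_combination hd2
  · field_simp; linear_combination hd2

theorem LineClosed.eq_univ_of_standard_parallel {B : Set Heis} (hB : LineClosed B) {h : ℝ}
    (h0 : ∀ s : ℝ, (s, 0, 0) ∈ B) (h1 : ∀ t : ℝ, (t, 1, h - t) ∈ B) : B = univ := by
  have hQ : ∀ x y z : ℝ, x * y - z * (1 - 2 * y) - h * y ^ 2 = 0 → (x, y, z) ∈ B := by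
    have hM : ∀ s t : ℝ, (s + t * (h - 2 * s), t, t * s) ∈ B := by
      intro s t
      have h2 := h1 (h - s)
      have := hB (s, 0, 0) (h - s, 1, h - (h - s)) (by simp) (by simp [HRel]) (h0 s) h2 t
      convert this using 1
      ext <;> simp
      · left; ring
    intro x y z hF
    by_cases hy : y = 0
    · subst hy
      have hz : z = 0 := by linarith
      subst hz
      exact h0 x
    · convert hM (z / y) y using 1
      ext <;> simp
      · field_simp; linear_combination hF
      · field_simp
  have hy : ∀ p : Heis, p.2.1 ≠ 1 / 2 → p ∈ B := by
    rintro ⟨x, y, z⟩ hy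
    simp only at hy
    by_cases hF : x * y - z * (1 - 2 * y) - h * y ^ 2 = 0
    · exact hQ x y z hF
    set F := x * y - z * (1 - 2 * y) - h * y ^ 2 with hFdef
    have hy' : 1 - 2 * y ≠ 0 := fun h => hy (by linarith)
    obtain ⟨a, ha⟩ : ∃ a : ℝ, a * (1 - 2 * y) + 2 * x - h = -F :=
      ⟨(-F - 2 * x + h) / (1 - 2 * y), by field_simp; ring⟩
    obtain ⟨s, t, hst, hs, ht⟩ := exists_two_roots (A := -F)
      (C := x + a * y + 2 * z - (x - y * a) * (1 - 2 * y) - 2 * h * y) (by simpa using hF)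
    have hm : ∀ r : ℝ, -F * r ^ 2 +
        (x + a * y + 2 * z - (x - y * a) * (1 - 2 * y) - 2 * h * y) * r - -F = 0 →
        hPt (x, y, z) a 1 r ∈ B := by
      intro r hr
      apply hQ
      simp only [mul_one]
      rw [← ha] at hr
      linear_combination hr + hFdef + ha
    simpa using hB.hPt_mem (by simp) hst (hm s hs) (hm t ht) 0
  ext p
  simp only [mem_univ, iff_true]
  by_cases hp : p.2.1 = 1 / 2
  · have := hB.hPt_mem (p := p) (a := 0) (b := 1) (s := 1) (t := 2) (by simp) (by norm_num)
      (hy _ (by simp [hPt, hp])) (hy _ (by simp [hPt, hp])) 0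
    simpa using this
  · exact hy p hp

theorem LineClosed.eq_univ_of_parallel {B : Set Heis} (hB : LineClosed B) {p q : Heis} {a b : ℝ}
    (hD : a * (q.2.1 - p.2.1) - b * (q.1 - p.1) ≠ 0) (hp : ∀ t, hPt p a b t ∈ B)
    (hq : ∀ t, hPt q a b t ∈ B) : B = univ := by
  set u := q.1 - p.1 with hu
  set v := q.2.1 - p.2.1 with hv
  set D := a * v - b * u with hDdef
  let T : Heis → Heis := fun w =>
    (p.1 + w.1 * a + w.2.1 * u, p.2.1 + w.1 * b + w.2.1 * v,
      p.2.2 + D * w.2.2 + p.1 * (w.1 * b + w.2.1 * v) - p.2.1 * (w.1 * a + w.2.1 * u))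
  have hsurj : ∀ w, ∃ w', T w' = w := by
    intro w
    refine ⟨(((w.1 - p.1) * v - (w.2.1 - p.2.1) * u) / D,
      ((w.2.1 - p.2.1) * a - (w.1 - p.1) * b) / D,
      (w.2.2 - p.2.2 - p.1 * (w.2.1 - p.2.1) + p.2.1 * (w.1 - p.1)) / D), ?_⟩
    have h1 : ((w.1 - p.1) * v - (w.2.1 - p.2.1) * u) / D * a +
        ((w.2.1 - p.2.1) * a - (w.1 - p.1) * b) / D * u = w.1 - p.1 := by
      field_simp; rw [hDdef]; ring
    have h2 : ((w.1 - p.1) * v - (w.2.1 - p.2.1) * u) / D * b +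
        ((w.2.1 - p.2.1) * a - (w.1 - p.1) * b) / D * v = w.2.1 - p.2.1 := by
      field_simp; rw [hDdef]; ring
    simp only [T, h1, h2, add_assoc, mul_div_cancel₀ _ hD]
    ext <;> simp <;> ring
  have hinj : ∀ w w', T w = T w' → w = w' := by
    intro w w' h
    simp only [T, Prod.mk.injEq] at h
    obtain ⟨h1, h2, h3⟩ := h
    have e1 : w.1 = w'.1 := mul_left_cancel₀ hD (by rw [hDdef]; linear_combination v * h1 - u * h2)
    have e2 : w.2.1 = w'.2.1 :=
      mul_left_cancel₀ hD (by rw [hDdef]; linear_combination a * h2 - b * h1)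
    rw [e1, e2] at h3
    have e3 : w.2.2 = w'.2.2 := mul_left_cancel₀ hD (by linarith)
    ext <;> assumption
  have hT : LineClosed (T ⁻¹' B) := by
    intro w w' hne hw h h' t
    have hrel : HRel (T w) (T w') := by
      simp only [HRel, T] at *
      rw [hDdef]; linear_combination D * hw
    have := hB _ _ (fun e => hne (hinj _ _ e)) hrel h h' t
    rw [mem_preimage]
    convert this using 1
    ext <;> simp [T] <;> ring
  have key := hT.eq_univ_of_standard_parallel
    (h := (q.2.2 - p.2.2 - p.1 * v + p.2.1 * u) / D) ?_ ?_
  · ext w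
    obtain ⟨w', rfl⟩ := hsurj w
    have : w' ∈ T ⁻¹' B := key ▸ mem_univ w'
    simpa using this
  · intro s
    rw [mem_preimage]
    convert hp s using 1
    ext <;> simp [T, hPt] <;> ring
  · intro t
    rw [mem_preimage]
    convert hq t using 1
    ext
    · simp [T, hPt, hu]; ring
    · simp [T, hPt, hv]; ring
    · simp only [T, hPt, mul_sub, mul_div_cancel₀ _ hD]
      rw [hDdef, hu, hv]; ring

theorem LineClosed.eq_univ_of_vertical {B : Set Heis} (hB : LineClosed B) {p q : Heis}
    {a b c d : ℝ} (hD : a * d - b * c ≠ 0) (h1 : p.1 = q.1) (h2 : p.2.1 = q.2.1)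
    (h3 : p.2.2 ≠ q.2.2) (hp : ∀ t, hPt p a b t ∈ B) (hq : ∀ t, hPt q c d t ∈ B) : B = univ := by
  obtain ⟨k, hk⟩ : ∃ k : ℝ, k * (a * d - b * c) = q.2.2 - p.2.2 :=
    ⟨(q.2.2 - p.2.2) / (a * d - b * c), by field_simp⟩
  have hk0 : q.2.2 - p.2.2 ≠ 0 := sub_ne_zero.2 h3.symm
  have hab : ¬(k * c - a = 0 ∧ k * d - b = 0) := by
    rintro ⟨e1, e2⟩
    apply hD
    linear_combination c * e2 - d * e1
  have hrel : ∀ s, s ^ 2 = 1 →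
      hPt q c d (s * k) = hPt (hPt p a b s) (k * c - a) (k * d - b) s := by
    intro s hs
    ext
    · simp only [hPt]; linear_combination -h1
    · simp only [hPt]; linear_combination -h2
    · simp only [hPt]; rw [h1, h2]; linear_combination (-s ^ 2) * hk + (p.2.2 - q.2.2) * hs
  have hline : ∀ s, s ^ 2 = 1 → ∀ t, hPt (hPt p a b s) (k * c - a) (k * d - b) t ∈ B := by
    intro s hs t
    refine hB.hPt_mem hab (s := 0) (t := s) ?_ ?_ ?_ t
    · rintro rfl; norm_num at hs
    · simpa using hp s
    · rw [← hrel s hs]; exact hq _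
  refine hB.eq_univ_of_parallel ?_ (hline 1 (by norm_num)) (hline (-1) (by norm_num))
  simp only [hPt]
  intro h
  apply hk0
  linear_combination -hk + h / 2

theorem LineClosed.exists_inter {B : Set Heis} (hB : LineClosed B) (hne : B ≠ univ) {p q : Heis}
    {a b c d : ℝ} (hD : a * d - b * c ≠ 0) (hp : ∀ t, hPt p a b t ∈ B)
    (hq : ∀ t, hPt q c d t ∈ B) : ∃ s t, hPt p a b s = hPt q c d t := by
  set D := a * d - b * c with hDdef
  let s := ((q.1 - p.1) * d - (q.2.1 - p.2.1) * c) / D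
  let t := ((q.1 - p.1) * b - (q.2.1 - p.2.1) * a) / D
  have e1 : (hPt p a b s).1 = (hPt q c d t).1 := by
    simp only [hPt, s, t]; field_simp; rw [hDdef]; ring
  have e2 : (hPt p a b s).2.1 = (hPt q c d t).2.1 := by
    simp only [hPt, s, t]; field_simp; rw [hDdef]; ring
  refine ⟨s, t, ?_⟩
  by_contra hcon
  have e3 : (hPt p a b s).2.2 ≠ (hPt q c d t).2.2 := fun e3 =>
    hcon (Prod.ext e1 (Prod.ext e2 e3))
  exact hne (hB.eq_univ_of_vertical hD e1 e2 e3 (fun r => by rw [hPt_hPt]; exact hp _)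
    (fun r => by rw [hPt_hPt]; exact hq _))

theorem hPt_mem_of_parallel {B : Set Heis} {p : Heis} {a b c d : ℝ} (hcd : ¬(c = 0 ∧ d = 0))
    (hD : a * d - b * c = 0) (hp : ∀ t, hPt p c d t ∈ B) (t : ℝ) : hPt p a b t ∈ B := by
  obtain ⟨k, rfl, rfl⟩ : ∃ k, a = k * c ∧ b = k * d := by
    rcases not_and_or.1 hcd with h | h
    · exact ⟨a / c, by field_simp, by field_simp; linarith⟩
    · exact ⟨b / d, by field_simp; linarith, by field_simp⟩
  convert hp (t * k) using 1
  simp only [hPt, Prod.mk.injEq]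
  refine ⟨?_, ?_, ?_⟩ <;> ring

theorem LineClosed.hRel_of_parallel {B : Set Heis} (hB : LineClosed B) (hne : B ≠ univ)
    {o r : Heis} {a b c d e f : ℝ} (hD : a * d - b * c ≠ 0) (h1 : ∀ t, hPt o a b t ∈ B)
    (h2 : ∀ t, hPt o c d t ∈ B) (hef : ¬(e = 0 ∧ f = 0)) (hr : ∀ t, hPt r e f t ∈ B)
    (hpar : a * f - b * e = 0) : HRel o r := by
  have hr' := hPt_mem_of_parallel hef hpar hr
  have hv : a * (r.2.1 - o.2.1) - b * (r.1 - o.1) = 0 := by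
    by_contra hv
    exact hne (hB.eq_univ_of_parallel hv h1 hr')
  obtain ⟨s, t, hst⟩ := hB.exists_inter hne hD hr' h2
  have ht : t = 0 := by
    have e1 := congrArg (fun w : Heis => w.1) hst
    have e2 := congrArg (fun w : Heis => w.2.1) hst
    simp only [hPt] at e1 e2
    refine (mul_eq_zero.1 (?_ : t * (a * d - b * c) = 0)).resolve_right hD
    linear_combination hv - a * e2 + b * e1
  rw [ht, hPt_zero] at hst
  rw [← hst]
  exact (hRel_self_hPt _ _ _ _).symm

theorem LineClosed.hRel_of_crossing {B : Set Heis} (hB : LineClosed B) (hne : B ≠ univ)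
    {o r : Heis} {a b c d e f : ℝ} (hD : a * d - b * c ≠ 0) (h1 : ∀ t, hPt o a b t ∈ B)
    (h2 : ∀ t, hPt o c d t ∈ B) (hef : ¬(e = 0 ∧ f = 0)) (hr : ∀ t, hPt r e f t ∈ B) :
    HRel o r := by
  by_cases hpar : a * f - b * e = 0
  · exact hB.hRel_of_parallel hne hD h1 h2 hef hr hpar
  by_cases hpar' : c * f - d * e = 0
  · exact hB.hRel_of_parallel hne (fun h => hD (by linarith)) h2 h1 hef hr hpar'
  obtain ⟨s, s', hs⟩ := hB.exists_inter hne hpar h1 hr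
  obtain ⟨t, t', ht⟩ := hB.exists_inter hne hpar' h2 hr
  have hrel : HRel (hPt o a b s) (hPt o c d t) := by
    rw [hs, ht]; exact hRel_hPt _ _ _ _ _
  have hst : s * t = 0 := by
    refine (mul_eq_zero.1 (?_ : (s * t) * (a * d - b * c) = 0)).resolve_right hD
    simp only [HRel, hPt] at hrel
    linear_combination -hrel
  rcases mul_eq_zero.1 hst with h | h
  · rw [h, hPt_zero] at hs
    rw [hs]; exact (hRel_self_hPt _ _ _ _).symm
  · rw [h, hPt_zero] at ht
    rw [ht]; exact (hRel_self_hPt _ _ _ _).symm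

theorem LineClosed.subset_plane {B : Set Heis} (hB : LineClosed B) (hne : B ≠ univ)
    (hline : ∀ p ∈ B, ∃ a b : ℝ, ¬(a = 0 ∧ b = 0) ∧ ∀ t, hPt p a b t ∈ B) :
    (∃ p : Heis, ∃ a b : ℝ, ¬(a = 0 ∧ b = 0) ∧
      ∀ q ∈ B, a * (q.2.1 - p.2.1) - b * (q.1 - p.1) = 0) ∨ ∃ o : Heis, ∀ q ∈ B, HRel o q := by
  rcases B.eq_empty_or_nonempty with rfl | ⟨p, hp⟩
  · exact Or.inr ⟨0, by simp⟩
  obtain ⟨a, b, hab, hpl⟩ := hline p hp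
  by_cases hvert : ∀ q ∈ B, a * (q.2.1 - p.2.1) - b * (q.1 - p.1) = 0
  · exact Or.inl ⟨p, a, b, hab, hvert⟩
  push Not at hvert
  obtain ⟨q, hq, hpq⟩ := hvert
  obtain ⟨c, d, hcd, hql⟩ := hline q hq
  have hD : a * d - b * c ≠ 0 := fun hD =>
    hne (hB.eq_univ_of_parallel hpq hpl (hPt_mem_of_parallel hcd hD hql))
  obtain ⟨s, t, hst⟩ := hB.exists_inter hne hD hpl hql
  refine Or.inr ⟨hPt p a b s, fun r hr => ?_⟩
  obtain ⟨e, f, hef, hrl⟩ := hline r hr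
  exact hB.hRel_of_crossing hne hD (fun τ => by rw [hPt_hPt]; exact hpl _)
    (fun τ => by rw [hst, hPt_hPt]; exact hql _) hef hrl

/-! ### Back to the group coordinates -/

theorem isLineR2_of_ne {p : Heis} {a b : ℝ} (hab : ¬(a = 0 ∧ b = 0)) :
    IsLineR2 {q : ℝ × ℝ | a * (q.2 - p.2.1) - b * (q.1 - p.1) = 0} := by
  refine ⟨(p.1, p.2.1), (a, b), by simpa [Prod.ext_iff] using hab, ?_⟩
  ext ⟨x, y⟩
  simp only [mem_ofPred_eq, Prod.smul_mk, smul_eq_mul, Prod.mk_add_mk, Prod.mk.injEq]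
  constructor
  · intro h
    rcases not_and_or.1 hab with h' | h'
    · exact ⟨(x - p.1) / a, by field_simp; ring, by field_simp; linarith⟩
    · exact ⟨(y - p.2.1) / b, by field_simp; linarith, by field_simp; ring⟩
  · rintro ⟨t, rfl, rfl⟩
    ring

theorem HRel.mem_horizPlane {o q : Heis} (h : HRel o q) :
    affineCoord.symm q ∈ horizPlane (affineCoord.symm o) := by
  have key : ∀ a b t : ℝ, ¬(a = 0 ∧ b = 0) →
      affineCoord.symm (hPt o a b t) ∈ horizPlane (affineCoord.symm o) := by
    intro a b t hab
    refine ⟨hLine (affineCoord.symm o) a b, ⟨_, a, b, hab, rfl⟩, ⟨0, ?_⟩,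
      ⟨t, affineCoord_symm_hPt o a b t⟩⟩
    rw [← affineCoord_symm_hPt, hPt_zero]
  by_cases hne : o = q
  · subst hne
    simpa using key 1 0 0 (by simp)
  · rw [h.eq_hPt_one]
    exact key _ _ 1 (h.dir_ne hne)

/-- If `E ⊆ H` is precisely monotone, then its topological frontier is contained in a
plane, or is all of `H`. -/
theorem statement14 (E : Set Heis) (hE : IsPreciselyMonotone E) :
    (∃ P : Set Heis, IsPlane P ∧ frontier E ⊆ P) ∨ frontier E = Set.univ := by
  have h1 : RayMonotone (affineCoord.symm ⁻¹' E) :=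
    rayMonotone_of_isPreconnected fun L hL => (hE L hL).1
  have h2 : RayMonotone (affineCoord.symm ⁻¹' E)ᶜ :=
    rayMonotone_of_isPreconnected (E := Eᶜ) fun L hL => (hE L hL).2
  have hfr := affineCoord.symm.preimage_frontier E
  have hmem : ∀ x ∈ frontier E, affineCoord x ∈ frontier (affineCoord.symm ⁻¹' E) := by
    intro x hx
    rw [← hfr]
    simpa using hx
  by_cases huniv : frontier (affineCoord.symm ⁻¹' E) = univ
  · right
    rw [← hfr, preimage_eq_univ_iff, affineCoord.symm.surjective.range_eq] at huniv
    exact univ_subset_iff.1 huniv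
  left
  rcases (h1.lineClosed_frontier h2).subset_plane huniv (fun p hp => h1.exists_line h2 hp) with
    ⟨p, a, b, hab, h⟩ | ⟨o, h⟩
  · exact ⟨_, Or.inl ⟨_, isLineR2_of_ne (p := p) hab, rfl⟩,
      fun x hx => h (affineCoord x) (hmem x hx)⟩
  · refine ⟨_, Or.inr ⟨affineCoord.symm o, rfl⟩, fun x hx => ?_⟩
    simpa using (h _ (hmem x hx)).mem_horizPlane
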